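/- Let 1 ≤ k ≤ n−1. The sequence 0 → R_{n,k} →^φ S_{n,k} →^π S_{n,k+1} → 0 is an exact sequence of S_n-modules, where π is the canonical projection (well-defined since J_{n,k} ⊆ J_{n,k+1}) and φ is induced by multiplication by e_{n−k}; that is, φ is injective, the image of φ equals the kernel of π, and π is surjective. -/

import Mathlib

open scoped BigOperators

namespace PackedWords

/-- An ordered set partition of `[n] = {1, …, n}` with `k` blocks: a sequence
`B_1 | ⋯ | B_k` of nonempty pairwise disjoint subsets of `[n]` whose union is `[n]`. -/
structure OSP (n k : ℕ) where
  blocks : Fin k → Finset ℕ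
  subset_range : ∀ j, blocks j ⊆ Finset.Icc 1 n
  blocks_nonempty : ∀ j, (blocks j).Nonempty
  blocks_disjoint : ∀ j₁ j₂ : Fin k, j₁ ≠ j₂ → Disjoint (blocks j₁) (blocks j₂)
  cover : ∀ i ∈ Finset.Icc 1 n, ∃ j, i ∈ blocks j

/-- Common generalization of the coinversion code (`b = 0`) and the boosted
coinversion code (`b = 1`).  Position `p : Fin n` corresponds to the letter
`i = p + 1` of `[n]`.  If `i ∈ B_j` (blocks indexed `0, …, k-1`, so `j` here is
the paper's `j - 1`), then `c_i = #{ℓ > j : min B_ℓ > i}` if `i = min B_j`, and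
`c_i = #{ℓ > j : min B_ℓ > i} + (j - 1) + b` (in the paper's 1-indexing) otherwise. -/
noncomputable def codeAux {n k : ℕ} (b : ℕ) (σ : OSP n k) (p : Fin n) : ℕ :=
  if h : ∃ j, ((p : ℕ) + 1) ∈ σ.blocks j then
    (Finset.univ.filter fun ℓ : Fin k =>
        h.choose < ℓ ∧ ∀ x ∈ σ.blocks ℓ, (p : ℕ) + 1 < x).card
      + (if ∀ x ∈ σ.blocks h.choose, (p : ℕ) + 1 ≤ x then 0 else (h.choose : ℕ) + b)
  else 0

/-- The coinversion code of an ordered set partition. -/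
noncomputable def code {n k : ℕ} (σ : OSP n k) : Fin n → ℕ := codeAux 0 σ

/-- The boosted coinversion code of an ordered set partition. -/
noncomputable def bcode {n k : ℕ} (σ : OSP n k) : Fin n → ℕ := codeAux 1 σ

/-- The skip sequence of a finite set `S = {s_1 < s_2 < ⋯} ⊆ ℕ`:
`γ_i = i - j + 1` if `i = s_j ∈ S`, and `γ_i = 0` otherwise. -/
def skip (S : Finset ℕ) (i : ℕ) : ℕ :=
  if i ∈ S then i - (S.filter (· < i)).card else 0

/-- The reverse skip sequence `γ(S)* = (γ_n, …, γ_1)` of `S ⊆ [n]`, read at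
position `p : Fin n` (so position `p` carries `γ_{n - p}` in 1-indexed terms). -/
def revSkipAt (n : ℕ) (S : Finset ℕ) (p : Fin n) : ℕ := skip S (n - (p : ℕ))

/-- For `T ⊆ [n-1]` with skip sequence `γ = γ(T)`, the length-`n` sequence
`(γ_{n-1}, …, γ_i, d, γ_{i-1}, …, γ_1)` obtained from the reverse skip sequence of `T`
by inserting `d` in position `n - i + 1` (1-indexed), read at position `p : Fin n`. -/
def insSeq (n i d : ℕ) (T : Finset ℕ) (p : Fin n) : ℕ :=
  if (p : ℕ) + 1 ≤ n - i then skip T (n - ((p : ℕ) + 1))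
  else if (p : ℕ) + 1 = n - i + 1 then d
  else skip T (n - ((p : ℕ) + 1) + 1)

/-- `Packedk n k w`: `w` is a packed word of length `n` on the alphabet of positive
integers (whenever `i + 1` appears as a letter, so does `i`) in which each of the
letters `1, 2, …, k` appears. -/
def Packedk (n k : ℕ) (w : Fin n → ℕ) : Prop :=
  (∀ p, 1 ≤ w p) ∧ (∀ i, 1 ≤ i → (∃ p, w p = i + 1) → ∃ p, w p = i) ∧
    (∀ j, 1 ≤ j → j ≤ k → ∃ p, w p = j)

/-- The elementary symmetric polynomial of degree `a` in the variables `X j`, `j ∈ s`. -/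
noncomputable def esymmOn (n : ℕ) (s : Finset (Fin n)) (a : ℕ) : MvPolynomial (Fin n) ℚ :=
  ∑ t ∈ s.powersetCard a, ∏ j ∈ t, MvPolynomial.X j

/-- The complete homogeneous symmetric polynomial of degree `b` evaluated at
`α 1, α 2, …, α d`. -/
noncomputable def hval (b d : ℕ) (α : ℕ → ℚ) : ℚ :=
  ∑ m : Sym (Fin d) b, ((m : Multiset (Fin d)).map fun j => α ((j : ℕ) + 1)).prod

/-- The locus `X_{n,k} ⊆ ℚ^n` of points `(α_{w_1}, …, α_{w_n})` for `w ∈ W_{n,k}`. -/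
def packedPoints (n k : ℕ) (α : ℕ → ℚ) : Set (Fin n → ℚ) :=
  {x | ∃ w : Fin n → ℕ, Packedk n k w ∧ x = fun p => α (w p)}

/-- The ideal `J_n = ⟨x_i^d e_{n-r}^{(i)} : 1 ≤ i ≤ n, 1 ≤ r ≤ d⟩`. -/
noncomputable def Jn (n : ℕ) : Ideal (MvPolynomial (Fin n) ℚ) :=
  Ideal.span {g | ∃ (i : Fin n) (r d : ℕ), 1 ≤ r ∧ r ≤ d ∧
    g = MvPolynomial.X i ^ d * esymmOn n {i}ᶜ (n - r)}

/-- The ideal `J_{n,k} = J_n + ⟨e_n, e_{n-1}, …, e_{n-k+1}⟩`. -/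
noncomputable def Jnk (n k : ℕ) : Ideal (MvPolynomial (Fin n) ℚ) :=
  Jn n ⊔ Ideal.span {g | ∃ j : ℕ, n - k + 1 ≤ j ∧ j ≤ n ∧ g = esymmOn n Finset.univ j}

/-- The Haglund–Rhoades–Shimozono ideal
`I_{n,k} = ⟨x_1^k, …, x_n^k, e_n, e_{n-1}, …, e_{n-k+1}⟩`. -/
noncomputable def Ink (n k : ℕ) : Ideal (MvPolynomial (Fin n) ℚ) :=
  Ideal.span ({g | ∃ i : Fin n, g = MvPolynomial.X i ^ k} ∪
    {g | ∃ j : ℕ, n - k + 1 ≤ j ∧ j ≤ n ∧ g = esymmOn n Finset.univ j})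

/-- `T(X)`: the ideal generated by the top-degree homogeneous components `τ(f)` of
all nonzero polynomials `f` vanishing on `X`. -/
noncomputable def gradedIdeal (n : ℕ) (X : Set (Fin n → ℚ)) : Ideal (MvPolynomial (Fin n) ℚ) :=
  Ideal.span {g | ∃ f : MvPolynomial (Fin n) ℚ, f ≠ 0 ∧
    (∀ x ∈ X, MvPolynomial.eval x f = 0) ∧
    g = MvPolynomial.homogeneousComponent f.totalDegree f}

/-- The degree-`d` homogeneous component of the quotient `ℚ[x_1, …, x_n]/I`,
namely the image of the space of homogeneous polynomials of degree `d`. -/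
noncomputable def quotComp (n : ℕ) (I : Ideal (MvPolynomial (Fin n) ℚ)) (d : ℕ) :
    Submodule ℚ (MvPolynomial (Fin n) ℚ ⧸ I) :=
  Submodule.map (Ideal.Quotient.mkₐ ℚ I).toLinearMap
    (MvPolynomial.homogeneousSubmodule (Fin n) ℚ d)

/-- The degree-`(d - a)` homogeneous component of `ℚ[x_1, …, x_n]/I`, interpreted as
zero when `d - a < 0` (degree shift by `a`). -/
noncomputable def quotCompShift (n : ℕ) (I : Ideal (MvPolynomial (Fin n) ℚ)) (d a : ℕ) :
    Submodule ℚ (MvPolynomial (Fin n) ℚ ⧸ I) :=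
  if a ≤ d then quotComp n I (d - a) else ⊥

lemma packedk_comp {n k : ℕ} {w : Fin n → ℕ} (σ : Equiv.Perm (Fin n)) (h : Packedk n k w) :
    Packedk n k (w ∘ σ) := by
  obtain ⟨h1, h2, h3⟩ := h
  refine ⟨fun p => h1 _, fun i hi hex => ?_, fun j hj hjk => ?_⟩
  · obtain ⟨q, hq⟩ := h2 i hi (by obtain ⟨p, hp⟩ := hex; exact ⟨σ p, hp⟩)
    exact ⟨σ.symm q, by simpa using hq⟩
  · obtain ⟨q, hq⟩ := h3 j hj hjk
    exact ⟨σ.symm q, by simpa using hq⟩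

/-- The left action of a permutation `σ ∈ S_n` on packed words, sending `w` to
`w ∘ σ⁻¹` (the permutation action on positions). -/
noncomputable def wordPerm (n k : ℕ) (σ : Equiv.Perm (Fin n)) :
    {w : Fin n → ℕ // Packedk n k w} ≃ {w : Fin n → ℕ // Packedk n k w} where
  toFun w := ⟨w.1 ∘ σ.symm, packedk_comp σ.symm w.2⟩
  invFun w := ⟨w.1 ∘ σ, packedk_comp σ w.2⟩
  left_inv w := Subtype.ext (funext fun p => by simp)
  right_inv w := Subtype.ext (funext fun p => by simp)

section EsymmOn

variable {n : ℕ}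

lemma esymmOn_zero (s : Finset (Fin n)) : esymmOn n s 0 = 1 := by
  simp [esymmOn]

lemma esymmOn_eq_zero_of_card_lt {s : Finset (Fin n)} {j : ℕ} (h : s.card < j) :
    esymmOn n s j = 0 := by
  simp [esymmOn, Finset.powersetCard_eq_empty.2 h]

lemma esymmOn_insert_succ {a : Fin n} {s : Finset (Fin n)} (ha : a ∉ s) (j : ℕ) :
    esymmOn n (insert a s) (j + 1) =
      esymmOn n s (j + 1) + MvPolynomial.X a * esymmOn n s j := by
  classical
  unfold esymmOn
  rw [Finset.powersetCard_succ_insert ha, Finset.sum_union, Finset.sum_image, Finset.mul_sum]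
  · congr 1
    refine Finset.sum_congr rfl fun t ht => ?_
    exact Finset.prod_insert fun h => ha ((Finset.mem_powersetCard.1 ht).1 h)
  · intro t ht u hu htu
    have h1 : a ∉ t := fun h => ha ((Finset.mem_powersetCard.1 ht).1 h)
    have h2 : a ∉ u := fun h => ha ((Finset.mem_powersetCard.1 hu).1 h)
    rw [← Finset.erase_insert h1, ← Finset.erase_insert h2, htu]
  · rw [Finset.disjoint_left]
    intro t ht ht'
    obtain ⟨u, -, rfl⟩ := Finset.mem_image.1 ht'
    exact ha ((Finset.mem_powersetCard.1 ht).1 (Finset.mem_insert_self a u))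

lemma esymmOn_univ_succ (i : Fin n) (j : ℕ) :
    esymmOn n Finset.univ (j + 1) =
      esymmOn n {i}ᶜ (j + 1) + MvPolynomial.X i * esymmOn n {i}ᶜ j := by
  classical
  rw [← esymmOn_insert_succ (by simp)]
  congr 1
  ext x
  simp

lemma esymmOn_mem_supported (s : Finset (Fin n)) (j : ℕ) :
    esymmOn n s j ∈ MvPolynomial.supported ℚ (s : Set (Fin n)) := by
  refine Subalgebra.sum_mem _ fun t ht => Subalgebra.prod_mem _ fun i hi => ?_
  exact MvPolynomial.X_mem_supported.2 ((Finset.mem_powersetCard.1 ht).1 hi)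

lemma isHomogeneous_esymmOn (s : Finset (Fin n)) (j : ℕ) :
    (esymmOn n s j).IsHomogeneous j := by
  refine MvPolynomial.IsHomogeneous.sum _ _ _ fun t ht => ?_
  have h := MvPolynomial.IsHomogeneous.prod t (fun i => (MvPolynomial.X i : MvPolynomial (Fin n) ℚ))
    (fun _ => 1) fun i _ => MvPolynomial.isHomogeneous_X ℚ i
  simpa [(Finset.mem_powersetCard.1 ht).2] using h

lemma exists_eq_add_X_mul {a : Fin n} {s : Finset (Fin n)} {p : MvPolynomial (Fin n) ℚ}
    (hp : p ∈ MvPolynomial.supported ℚ ((insert a s : Finset (Fin n)) : Set (Fin n))) :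
    ∃ q ∈ MvPolynomial.supported ℚ (s : Set (Fin n)),
      ∃ r ∈ MvPolynomial.supported ℚ ((insert a s : Finset (Fin n)) : Set (Fin n)),
        p = q + MvPolynomial.X a * r := by
  have hle : MvPolynomial.supported ℚ (s : Set (Fin n)) ≤
      MvPolynomial.supported ℚ ((insert a s : Finset (Fin n)) : Set (Fin n)) :=
    MvPolynomial.supported_mono (by simp)
  have ha : MvPolynomial.X a ∈
      MvPolynomial.supported ℚ ((insert a s : Finset (Fin n)) : Set (Fin n)) :=
    MvPolynomial.X_mem_supported.2 (by simp)
  rw [MvPolynomial.supported_eq_adjoin_X] at hp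
  induction hp using Algebra.adjoin_induction with
  | mem x hx =>
    obtain ⟨i, hi, rfl⟩ := hx
    rcases Finset.mem_insert.1 (Finset.mem_coe.1 hi) with rfl | hi
    · exact ⟨0, Subalgebra.zero_mem _, 1, Subalgebra.one_mem _, by simp⟩
    · exact ⟨_, MvPolynomial.X_mem_supported.2 hi, 0, Subalgebra.zero_mem _, by simp⟩
  | algebraMap c => exact ⟨_, Subalgebra.algebraMap_mem _ c, 0, Subalgebra.zero_mem _, by simp⟩
  | add x y _ _ hx hy =>
    obtain ⟨q, hq, r, hr, rfl⟩ := hx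
    obtain ⟨q', hq', r', hr', rfl⟩ := hy
    exact ⟨q + q', add_mem hq hq', r + r', add_mem hr hr', by ring⟩
  | mul x y _ _ hx hy =>
    obtain ⟨q, hq, r, hr, rfl⟩ := hx
    obtain ⟨q', hq', r', hr', rfl⟩ := hy
    exact ⟨q * q', mul_mem hq hq', q * r' + r * q' + MvPolynomial.X a * r * r',
      add_mem (add_mem (mul_mem (hle hq) hr') (mul_mem hr (hle hq')))
        (mul_mem (mul_mem ha hr) hr'), by ring⟩

end EsymmOn

/-- The number of functions from an `n`-element set to a `k`-element set whose image contains
`s` prescribed elements. -/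
def coverCount (k : ℕ) : ℕ → ℕ → ℕ
  | 0, 0 => 1
  | 0, _ + 1 => 0
  | n + 1, s => s * coverCount k n (s - 1) + (k - s) * coverCount k n s

lemma natCard_image_contains (k n : ℕ) (S : Finset (Fin k)) :
    Nat.card {f : Fin n → Fin k // ∀ l ∈ S, ∃ p, f p = l} = coverCount k n S.card := by
  induction n generalizing S with
  | zero =>
    rcases S.eq_empty_or_nonempty with rfl | hS
    · simp [coverCount]
    · obtain ⟨m, hm⟩ := Nat.exists_eq_succ_of_ne_zero hS.card_pos.ne'
      rw [hm]
      simp only [coverCount]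
      obtain ⟨l, hl⟩ := hS
      have : IsEmpty {f : Fin 0 → Fin k // ∀ l ∈ S, ∃ p, f p = l} :=
        ⟨fun f => (f.2 l hl).choose.elim0⟩
      exact Nat.card_of_isEmpty
  | succ n ih =>
    have e : {f : Fin (n + 1) → Fin k // ∀ l ∈ S, ∃ p, f p = l} ≃
        Σ a : Fin k, {f : Fin n → Fin k // ∀ l ∈ S.erase a, ∃ p, f p = l} :=
      { toFun := fun f => ⟨f.1 0, Fin.tail f.1, fun l hl => by
          obtain ⟨p, hp⟩ := f.2 l (Finset.mem_of_mem_erase hl)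
          induction p using Fin.cases with
          | zero => exact absurd hp.symm (Finset.ne_of_mem_erase hl)
          | succ p => exact ⟨p, hp⟩⟩
        invFun := fun g => ⟨Fin.cons g.1 g.2.1, fun l hl => by
          by_cases h : l = g.1
          · exact ⟨0, by simp [h]⟩
          · obtain ⟨p, hp⟩ := g.2.2 l (Finset.mem_erase.2 ⟨h, hl⟩)
            exact ⟨p.succ, by simpa using hp⟩⟩
        left_inv := fun f => Subtype.ext (Fin.cons_self_tail f.1)
        right_inv := fun g => by rcases g with ⟨a, g, hg⟩; rfl }
    rw [Nat.card_congr e, Nat.card_sigma]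
    simp only [ih]
    rw [← Finset.sum_add_sum_compl S]
    have h1 : ∀ a ∈ S, coverCount k n (S.erase a).card = coverCount k n (S.card - 1) :=
      fun a ha => by rw [Finset.card_erase_of_mem ha]
    have h2 : ∀ a ∈ Sᶜ, coverCount k n (S.erase a).card = coverCount k n S.card :=
      fun a ha => by rw [Finset.erase_eq_of_notMem (Finset.mem_compl.1 ha)]
    rw [Finset.sum_congr rfl h1, Finset.sum_congr rfl h2]
    simp [coverCount, Finset.card_compl]

lemma exists_finset_span_mul {n k : ℕ} (t : Finset (Fin n)) {s : ℕ} (hs : s ≤ k)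
    {I : Submodule ℚ (MvPolynomial (Fin n) ℚ)}
    (hI : ∀ p ∈ MvPolynomial.supported ℚ (t : Set (Fin n)), ∀ z ∈ I, p * z ∈ I)
    {v : MvPolynomial (Fin n) ℚ} (hpow : ∀ i ∈ t, MvPolynomial.X i ^ k * v ∈ I)
    (he : ∀ j, t.card < j + s → esymmOn n t j * v ∈ I) :
    ∃ B : Finset (MvPolynomial (Fin n) ℚ), B.card ≤ coverCount k t.card s ∧
      ∀ p ∈ MvPolynomial.supported ℚ (t : Set (Fin n)),
        p * v ∈ Submodule.span ℚ (B : Set (MvPolynomial (Fin n) ℚ)) ⊔ I := by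
  classical
  induction t using Finset.induction_on generalizing s I v with
  | empty =>
    cases s with
    | zero =>
      refine ⟨{v}, by simp [coverCount], fun p hp => ?_⟩
      simp only [Finset.coe_empty, MvPolynomial.supported_empty, Algebra.mem_bot,
        Set.mem_range] at hp
      obtain ⟨c, rfl⟩ := hp
      rw [← Algebra.smul_def]
      exact Submodule.mem_sup_left (Submodule.smul_mem _ _ (Submodule.subset_span (by simp)))
    | succ s =>
      refine ⟨∅, by simp, fun p hp => Submodule.mem_sup_right (hI p hp _ ?_)⟩
      simpa [esymmOn_zero] using he 0 (by simp)
  | insert a t ha ih =>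
    rw [Finset.card_insert_of_notMem ha] at he ⊢
    set Q := MvPolynomial.supported ℚ ((insert a t : Finset (Fin n)) : Set (Fin n)) with hQ
    have hle : MvPolynomial.supported ℚ (t : Set (Fin n)) ≤ Q :=
      MvPolynomial.supported_mono (by simp)
    have hXa : MvPolynomial.X a ∈ Q := MvPolynomial.X_mem_supported.2 (by simp)
    have key : ∀ m ≤ s, ∀ j, j + m = t.card + 1 →
        MvPolynomial.X a ^ m * esymmOn n t j * v ∈ I := by
      intro m
      induction m with
      | zero =>
        intro _ j hj
        rw [esymmOn_eq_zero_of_card_lt (by omega)]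
        simp
      | succ m ihm =>
        intro hm j hj
        have h1 := ihm (by omega) (j + 1) (by omega)
        have h2 := hI _ (pow_mem hXa m) _ (he (j + 1) (by omega))
        rw [esymmOn_insert_succ ha] at h2
        have := sub_mem h2 h1
        convert this using 1
        ring
    have layers : ∀ i ≤ k, ∃ B : Finset (MvPolynomial (Fin n) ℚ),
        B.card ≤ ∑ j ∈ Finset.Ico i k,
          (if j < s then coverCount k t.card (s - 1) else coverCount k t.card s) ∧
        ∀ p ∈ Q, p * (MvPolynomial.X a ^ i * v) ∈
          Submodule.span ℚ (B : Set (MvPolynomial (Fin n) ℚ)) ⊔ I := by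
      intro i hik
      induction hik using Nat.decreasingInduction with
      | self =>
        exact ⟨∅, by simp, fun p hp =>
          Submodule.mem_sup_right (hI p hp _ (hpow a (Finset.mem_insert_self a t)))⟩
      | of_succ i hik ihi =>
        obtain ⟨B, hBcard, hB⟩ := ihi
        let I' : Submodule ℚ (MvPolynomial (Fin n) ℚ) :=
          I ⊔ Q.toSubmodule.map (LinearMap.mulRight ℚ (MvPolynomial.X a ^ (i + 1) * v))
        have hmemQ : ∀ p ∈ Q, p * (MvPolynomial.X a ^ (i + 1) * v) ∈ I' := fun p hp =>
          Submodule.mem_sup_right ⟨p, hp, rfl⟩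
        have hI' : ∀ p ∈ MvPolynomial.supported ℚ (t : Set (Fin n)), ∀ z ∈ I', p * z ∈ I' := by
          intro p hp z hz
          obtain ⟨x, hx, y, ⟨q, hq, rfl⟩, rfl⟩ := Submodule.mem_sup.1 hz
          rw [mul_add]
          refine add_mem (Submodule.mem_sup_left (hI p (hle hp) x hx)) ?_
          rw [LinearMap.mulRight_apply, ← mul_assoc]
          exact hmemQ _ (mul_mem (hle hp) hq)
        have hpow' : ∀ j ∈ t, MvPolynomial.X j ^ k * (MvPolynomial.X a ^ i * v) ∈ I' := by
          intro j hj
          have := hI _ (pow_mem hXa i) _ (hpow j (Finset.mem_insert_of_mem hj))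
          rw [mul_left_comm] at this
          exact Submodule.mem_sup_left this
        have he' : ∀ j, t.card + 1 < j + s → esymmOn n t j * (MvPolynomial.X a ^ i * v) ∈ I' := by
          intro j hj
          have h1 := hI _ (pow_mem hXa i) _ (he j hj)
          cases j with
          | zero =>
            rw [esymmOn_zero] at h1 ⊢
            rw [mul_left_comm] at h1
            exact Submodule.mem_sup_left h1
          | succ j =>
            rw [esymmOn_insert_succ ha] at h1
            have := sub_mem (Submodule.mem_sup_left h1)
              (hmemQ _ (hle (esymmOn_mem_supported t j)))
            convert this using 1
            ring
        have hstep : ∃ B' : Finset (MvPolynomial (Fin n) ℚ),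
            B'.card ≤ (if i < s then coverCount k t.card (s - 1) else coverCount k t.card s) ∧
            ∀ p ∈ MvPolynomial.supported ℚ (t : Set (Fin n)),
              p * (MvPolynomial.X a ^ i * v) ∈
                Submodule.span ℚ (B' : Set (MvPolynomial (Fin n) ℚ)) ⊔ I' := by
          split_ifs with his
          · exact ih (by omega) hI' hpow' fun j hj => he' j (by omega)
          · refine ih hs hI' hpow' fun j hj => ?_
            rcases Nat.lt_or_ge (t.card + 1) (j + s) with h | h
            · exact he' j h
            · have h1 := hI _ (pow_mem hXa (i - s)) _ (key s le_rfl j (by omega))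
              refine Submodule.mem_sup_left ?_
              convert h1 using 1
              rw [← pow_sub_mul_pow _ (not_lt.1 his)]
              ring
        obtain ⟨B', hBcard', hB'⟩ := hstep
        have hleB : Submodule.span ℚ (B : Set (MvPolynomial (Fin n) ℚ)) ⊔ I ≤
            Submodule.span ℚ ((B' ∪ B : Finset _) : Set (MvPolynomial (Fin n) ℚ)) ⊔ I :=
          sup_le_sup_right (Submodule.span_mono (by simp)) _
        refine ⟨B' ∪ B, ?_, fun p hp => ?_⟩
        · rw [Finset.sum_eq_sum_Ico_succ_bot hik]
          exact (Finset.card_union_le _ _).trans (add_le_add hBcard' hBcard)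
        · obtain ⟨q, hq, r, hr, rfl⟩ := exists_eq_add_X_mul hp
          have h1 := hB r hr
          have h2 := hB' q hq
          have h3 : Submodule.span ℚ (B' : Set (MvPolynomial (Fin n) ℚ)) ⊔ I' ≤
              Submodule.span ℚ ((B' ∪ B : Finset _) : Set (MvPolynomial (Fin n) ℚ)) ⊔ I := by
            refine sup_le ((Submodule.span_mono (by simp)).trans le_sup_left)
              (sup_le le_sup_right ?_)
            rintro _ ⟨q, hq, rfl⟩
            exact hleB (hB q hq)
          have := add_mem (h3 h2) (hleB h1)
          convert this using 1
          ring
    obtain ⟨B, hBcard, hB⟩ := layers 0 (Nat.zero_le k)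
    refine ⟨B, hBcard.trans (le_of_eq ?_), fun p hp => by simpa using hB p hp⟩
    rw [coverCount, ← Finset.sum_Ico_consecutive _ (Nat.zero_le s) hs,
      Finset.sum_congr rfl fun j hj => if_pos (Finset.mem_Ico.1 hj).2,
      Finset.sum_congr rfl fun j hj => if_neg (not_lt.2 (Finset.mem_Ico.1 hj).1)]
    simp

lemma finite_and_finrank_le_of_span {n : ℕ} (I : Ideal (MvPolynomial (Fin n) ℚ))
    (B : Finset (MvPolynomial (Fin n) ℚ))
    (hB : ∀ p, p ∈ Submodule.span ℚ (B : Set (MvPolynomial (Fin n) ℚ)) ⊔ I.restrictScalars ℚ) :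
    Module.Finite ℚ (MvPolynomial (Fin n) ℚ ⧸ I) ∧
      Module.finrank ℚ (MvPolynomial (Fin n) ℚ ⧸ I) ≤ B.card := by
  classical
  let f := (Ideal.Quotient.mkₐ ℚ I).toLinearMap
  have htop : Submodule.span ℚ ((B.image f : Finset _) : Set (MvPolynomial (Fin n) ℚ ⧸ I)) = ⊤ := by
    rw [eq_top_iff]
    rintro x -
    obtain ⟨p, rfl⟩ := Ideal.Quotient.mk_surjective x
    obtain ⟨b, hb, c, hc, rfl⟩ := Submodule.mem_sup.1 (hB p)
    rw [map_add, Ideal.Quotient.eq_zero_iff_mem.2 hc, add_zero, Finset.coe_image,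
      Submodule.span_image]
    exact ⟨b, hb, rfl⟩
  have hfin : Module.Finite ℚ (MvPolynomial (Fin n) ℚ ⧸ I) := ⟨⟨_, htop⟩⟩
  refine ⟨hfin, ?_⟩
  have h := finrank_span_finset_le_card (R := ℚ) (B.image f)
  rw [Set.finrank, htop, finrank_top] at h
  exact h.trans Finset.card_image_le

lemma finite_and_finrank_quotient_Ink_le {n k : ℕ} (hkn : k ≤ n) :
    Module.Finite ℚ (MvPolynomial (Fin n) ℚ ⧸ Ink n k) ∧
      Module.finrank ℚ (MvPolynomial (Fin n) ℚ ⧸ Ink n k) ≤ coverCount k n k := by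
  obtain ⟨B, hBcard, hB⟩ := exists_finset_span_mul (k := k) (Finset.univ : Finset (Fin n))
    (le_refl k) (I := (Ink n k).restrictScalars ℚ) (v := 1)
    (fun p _ z hz => Ideal.mul_mem_left _ p hz)
    (fun i _ => by
      rw [mul_one]
      exact Ideal.subset_span (Or.inl ⟨i, rfl⟩))
    (fun j hj => by
      rw [mul_one]
      rw [Finset.card_univ, Fintype.card_fin] at hj
      rcases Nat.lt_or_ge n j with h | h
      · rw [esymmOn_eq_zero_of_card_lt (by simpa using h)]
        exact zero_mem _
      · exact Ideal.subset_span (Or.inr ⟨j, by omega, h, rfl⟩))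
  rw [Finset.card_univ, Fintype.card_fin] at hBcard
  have := finite_and_finrank_le_of_span (Ink n k) B fun p => by
    simpa using hB p (by simp [MvPolynomial.supported_univ])
  exact ⟨this.1, this.2.trans hBcard⟩

/-- The space of polynomials all of whose monomials have degree less than `m`. -/
def degreeLT (n m : ℕ) : Submodule ℚ (MvPolynomial (Fin n) ℚ) where
  carrier := {p | ∀ e : Fin n →₀ ℕ, m ≤ e.degree → p.coeff e = 0}
  add_mem' hp hq e he := by simp [hp e he, hq e he]
  zero_mem' e _ := by simp
  smul_mem' c p hp e he := by simp [hp e he]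

section DegreeLT

variable {n : ℕ}

lemma mem_degreeLT {m : ℕ} {p : MvPolynomial (Fin n) ℚ} :
    p ∈ degreeLT n m ↔ ∀ e : Fin n →₀ ℕ, m ≤ e.degree → p.coeff e = 0 := Iff.rfl

lemma degreeLT_mono {a b : ℕ} (h : a ≤ b) : degreeLT n a ≤ degreeLT n b :=
  fun _ hp e he => hp e (h.trans he)

lemma exists_mem_degreeLT (p : MvPolynomial (Fin n) ℚ) : ∃ m, p ∈ degreeLT n m := by
  refine ⟨p.totalDegree + 1, fun e he => ?_⟩
  refine MvPolynomial.coeff_eq_zero_of_totalDegree_lt ?_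
  rw [Finsupp.degree_eq_sum] at he
  rw [Finset.sum_subset (Finset.subset_univ _) (by simp)]
  omega

lemma IsHomogeneous.mem_degreeLT {d : ℕ} {p : MvPolynomial (Fin n) ℚ} (hp : p.IsHomogeneous d) :
    p ∈ degreeLT n (d + 1) :=
  fun e he => hp.coeff_eq_zero (by omega)

lemma mul_mem_degreeLT {a b : ℕ} {p q : MvPolynomial (Fin n) ℚ} (hp : p ∈ degreeLT n (a + 1))
    (hq : q ∈ degreeLT n b) : p * q ∈ degreeLT n (a + b) := by
  classical
  intro e he
  rw [MvPolynomial.coeff_mul]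
  refine Finset.sum_eq_zero fun u hu => ?_
  have h : u.1.degree + u.2.degree = e.degree := by
    rw [← Finset.HasAntidiagonal.mem_antidiagonal.1 hu, map_add]
  rcases Nat.lt_or_ge a u.1.degree with h1 | h1
  · rw [hp _ h1, zero_mul]
  · rw [hq _ (by omega), mul_zero]

lemma sub_homogeneousComponent_mem_degreeLT {d : ℕ} {p : MvPolynomial (Fin n) ℚ}
    (hp : p ∈ degreeLT n (d + 1)) :
    p - MvPolynomial.homogeneousComponent d p ∈ degreeLT n d := by
  intro e he
  rw [MvPolynomial.coeff_sub, MvPolynomial.coeff_homogeneousComponent]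
  split_ifs with h
  · simp
  · rw [hp e (by omega), sub_zero]

lemma homogeneousComponent_mul_of_isHomogeneous {d i j : ℕ} {p q : MvPolynomial (Fin n) ℚ}
    (hp : p.IsHomogeneous i) (hq : q.IsHomogeneous j) :
    MvPolynomial.homogeneousComponent d (p * q) = if i + j = d then p * q else 0 := by
  rw [MvPolynomial.homogeneousComponent_of_mem (hp.mul hq)]
  simp only [eq_comm]

/-- `LeadingForm f g d` says that `g` is homogeneous of degree `d` and that `f` equals `g` up to
terms of degree less than `d`. -/
def LeadingForm (f g : MvPolynomial (Fin n) ℚ) (d : ℕ) : Prop :=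
  g.IsHomogeneous d ∧ f - g ∈ degreeLT n d

lemma LeadingForm.mul {f g f' g' : MvPolynomial (Fin n) ℚ} {d d' : ℕ} (h : LeadingForm f g d)
    (h' : LeadingForm f' g' d') : LeadingForm (f * f') (g * g') (d + d') := by
  refine ⟨h.1.mul h'.1, ?_⟩
  have hf : f ∈ degreeLT n (d + 1) := by
    have := add_mem (degreeLT_mono (Nat.le_succ d) h.2) (IsHomogeneous.mem_degreeLT h.1)
    simpa using this
  have h1 := mul_mem_degreeLT hf h'.2
  have h2 := mul_mem_degreeLT (IsHomogeneous.mem_degreeLT h'.1) h.2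
  rw [add_comm d'] at h2
  convert add_mem h1 h2 using 1
  ring

lemma leadingForm_one : LeadingForm (1 : MvPolynomial (Fin n) ℚ) 1 0 :=
  ⟨MvPolynomial.isHomogeneous_one _ _, by simp⟩

lemma leadingForm_X_sub_C (i : Fin n) (c : ℚ) :
    LeadingForm (MvPolynomial.X i - MvPolynomial.C c) (MvPolynomial.X i) 1 := by
  refine ⟨MvPolynomial.isHomogeneous_X _ _, ?_⟩
  rw [sub_sub_cancel_left]
  exact neg_mem (IsHomogeneous.mem_degreeLT (MvPolynomial.isHomogeneous_C _ c))

lemma leadingForm_prod_X_sub_C (i : Fin n) (c : ℕ → ℚ) (d : ℕ) :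
    LeadingForm (∏ l ∈ Finset.range d, (MvPolynomial.X i - MvPolynomial.C (c l)))
      (MvPolynomial.X i ^ d) d := by
  induction d with
  | zero => simpa using leadingForm_one
  | succ d ih =>
    rw [Finset.prod_range_succ, pow_succ]
    exact ih.mul (leadingForm_X_sub_C i (c d))

/-- The ideal generated by leading forms of polynomials vanishing on a finite set of points has
codimension at least the number of points. -/
lemma card_le_finrank_quotient_span {X : Type*} [Fintype X] {x : X → Fin n → ℚ}
    (hx : Function.Injective x) {G : Set (MvPolynomial (Fin n) ℚ)}
    (hG : ∀ g ∈ G, ∃ f d, LeadingForm f g d ∧ ∀ a, MvPolynomial.eval (x a) f = 0)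
    [Module.Finite ℚ (MvPolynomial (Fin n) ℚ ⧸ Ideal.span G)] :
    Fintype.card X ≤ Module.finrank ℚ (MvPolynomial (Fin n) ℚ ⧸ Ideal.span G) := by
  classical
  let J := Ideal.span G
  let K : Submodule ℚ (MvPolynomial (Fin n) ℚ) :=
    ⨅ a, LinearMap.ker (MvPolynomial.aeval (x a)).toLinearMap
  have memK : ∀ f, f ∈ K ↔ ∀ a, MvPolynomial.eval (x a) f = 0 := fun f => by
    simp [K, Submodule.mem_iInf, MvPolynomial.aeval_eq_eval]
  have mulK : ∀ p, ∀ f ∈ K, p * f ∈ K := fun p f hf => by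
    rw [memK] at hf ⊢
    intro a
    rw [map_mul, hf a, mul_zero]
  have hcomp : ∀ j ∈ J, ∀ d, MvPolynomial.homogeneousComponent d j ∈ K ⊔ degreeLT n d := by
    intro j hj d
    suffices h : ∀ p, MvPolynomial.homogeneousComponent d (p * j) ∈ K ⊔ degreeLT n d by
      simpa using h 1
    induction hj using Submodule.span_induction with
    | mem g hg =>
      intro p
      obtain ⟨f, d', hfg, hf⟩ := hG g hg
      rw [p.as_sum, Finset.sum_mul, map_sum]
      refine Submodule.sum_mem _ fun e _ => ?_
      have he := MvPolynomial.isHomogeneous_monomial (p.coeff e) (rfl : e.degree = e.degree)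
      rw [homogeneousComponent_mul_of_isHomogeneous he hfg.1]
      split_ifs with hd
      · have h1 := mulK (MvPolynomial.monomial e (p.coeff e)) f ((memK f).2 hf)
        have h2 := mul_mem_degreeLT (IsHomogeneous.mem_degreeLT he) hfg.2
        rw [hd] at h2
        have := sub_mem (Submodule.mem_sup_left (T := degreeLT n d) h1)
          (Submodule.mem_sup_right (S := K) h2)
        convert this using 1
        ring
      · exact zero_mem _
    | zero => simp
    | add j j' _ _ h h' =>
      intro p
      rw [mul_add, map_add]
      exact add_mem (h p) (h' p)
    | smul c j _ h =>
      intro p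
      rw [smul_eq_mul, ← mul_assoc]
      exact h (p * c)
  let mon : (Fin n →₀ ℕ) → MvPolynomial (Fin n) ℚ := fun e => MvPolynomial.monomial e 1
  let f := (Ideal.Quotient.mkₐ ℚ J).toLinearMap
  obtain ⟨κ, a, -, hspan, hli⟩ := exists_linearIndependent' ℚ (f ∘ mon)
  have hfin : Finite κ := hli.finite
  have := Fintype.ofFinite κ
  have hcard : Fintype.card κ ≤ Module.finrank ℚ (MvPolynomial (Fin n) ℚ ⧸ J) :=
    hli.fintype_card_le_finrank
  refine le_trans ?_ hcard
  have hmon : ∀ p, p ∈ Submodule.span ℚ (Set.range mon) := fun p => by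
    rw [p.as_sum]
    refine Submodule.sum_mem _ fun e _ => ?_
    rw [← mul_one (p.coeff e), ← smul_eq_mul, ← MvPolynomial.smul_monomial]
    exact Submodule.smul_mem _ _ (Submodule.subset_span ⟨e, rfl⟩)
  set V := Submodule.span ℚ (Set.range (mon ∘ a)) with hV
  have hVcomp : ∀ d, ∀ p ∈ V, MvPolynomial.homogeneousComponent d p ∈ V := by
    intro d p hp
    induction hp using Submodule.span_induction with
    | mem p hp =>
      obtain ⟨i, rfl⟩ := hp
      rw [Function.comp_apply, MvPolynomial.homogeneousComponent_of_mem
        (MvPolynomial.isHomogeneous_monomial (1 : ℚ) rfl)]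
      split_ifs
      · exact Submodule.subset_span ⟨i, rfl⟩
      · exact zero_mem _
    | zero => simp
    | add p q _ _ hp hq => rw [map_add]; exact add_mem hp hq
    | smul c p _ hp => rw [map_smul]; exact Submodule.smul_mem _ _ hp
  have hred : ∀ p, ∃ v ∈ V, p - v ∈ J := by
    intro p
    have h : f p ∈ Submodule.span ℚ (Set.range ((f ∘ mon) ∘ a)) := by
      rw [hspan, Set.range_comp, Submodule.span_image]
      exact ⟨p, hmon p, rfl⟩
    rw [Function.comp_assoc, Set.range_comp, Submodule.span_image] at h
    obtain ⟨v, hv, hvp⟩ := h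
    exact ⟨v, hv, Ideal.Quotient.eq.1 hvp.symm⟩
  have hVK : ∀ d, degreeLT n d ≤ V ⊔ K := by
    intro d
    induction d with
    | zero =>
      intro p hp
      have : p = 0 := by ext e; exact hp e (Nat.zero_le _)
      rw [this]
      exact zero_mem _
    | succ d ih =>
      intro p hp
      have h1 := ih (sub_homogeneousComponent_mem_degreeLT hp)
      set q := MvPolynomial.homogeneousComponent d p with hq
      have hqh : MvPolynomial.homogeneousComponent d q = q := by
        rw [MvPolynomial.homogeneousComponent_of_mem
          (MvPolynomial.homogeneousComponent_isHomogeneous d p), if_pos rfl]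
      obtain ⟨v, hv, hvJ⟩ := hred q
      have h2 := hcomp _ hvJ d
      rw [map_sub, hqh] at h2
      have h3 : q - MvPolynomial.homogeneousComponent d v ∈ V ⊔ K :=
        (sup_le le_sup_right ih) h2
      have h4 := add_mem h3 (Submodule.mem_sup_left (T := K) (hVcomp d v hv))
      have := add_mem h1 h4
      simpa using this
  have hVtop : ∀ p, p ∈ V ⊔ K := fun p => by
    obtain ⟨m, hm⟩ := exists_mem_degreeLT p
    exact hVK m hm
  have hev : LinearIndependent ℚ fun (b : X) (p : MvPolynomial (Fin n) ℚ) =>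
      MvPolynomial.eval (x b) p := by
    have h := (linearIndependent_monoidHom (MvPolynomial (Fin n) ℚ) ℚ).comp
      (fun b : X => ((MvPolynomial.eval (x b) : MvPolynomial (Fin n) ℚ →+* ℚ) :
        MvPolynomial (Fin n) ℚ →* ℚ)) fun b c hbc => hx <| funext fun i => by
          simpa using DFunLike.congr_fun hbc (MvPolynomial.X i)
    exact h
  have hli' : LinearIndependent ℚ fun (b : X) (i : κ) => MvPolynomial.eval (x b) (mon (a i)) := by
    rw [Fintype.linearIndependent_iff] at hev ⊢
    intro c hc
    refine hev c (funext fun p => ?_)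
    let L : MvPolynomial (Fin n) ℚ →ₗ[ℚ] ℚ :=
      ∑ b, c b • (MvPolynomial.aeval (x b)).toLinearMap
    have hL : ∀ p, L p = ∑ b, c b * MvPolynomial.eval (x b) p := fun p => by
      simp [L, MvPolynomial.aeval_eq_eval]
    have hker : V ⊔ K ≤ LinearMap.ker L := by
      refine sup_le (Submodule.span_le.2 ?_) fun p hp => ?_
      · rintro _ ⟨i, rfl⟩
        have := congrFun hc i
        simpa [hL] using this
      · rw [memK] at hp
        simp [hL, hp]
    have := hker (hVtop p)
    rw [LinearMap.mem_ker, hL] at this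
    simpa using this
  simpa using hli'.fintype_card_le_finrank

end DegreeLT

section PackedPoints

variable {n : ℕ}

lemma eval_esymmOn (x : Fin n → ℚ) (s : Finset (Fin n)) (j : ℕ) :
    MvPolynomial.eval x (esymmOn n s j) = ∑ t ∈ s.powersetCard j, ∏ i ∈ t, x i := by
  simp [esymmOn, map_sum, map_prod]

lemma sum_eval_esymmOn_smul (x : Fin n → ℚ) (s : Finset (Fin n)) :
    ∑ m ∈ Finset.range (s.card + 1),
      MvPolynomial.eval x (esymmOn n s (s.card - m)) • (Polynomial.X : Polynomial ℚ) ^ m =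
      ∏ i ∈ s, (Polynomial.X + Polynomial.C (x i)) := by
  have hdeg : (∏ i ∈ s, (Polynomial.X + Polynomial.C (x i))).natDegree = s.card := by
    rw [Polynomial.natDegree_prod_of_monic _ _ fun i _ => Polynomial.monic_X_add_C (x i)]
    simp
  conv_rhs => rw [Polynomial.as_sum_range_C_mul_X_pow (∏ i ∈ s, _), hdeg]
  refine Finset.sum_congr rfl fun m hm => ?_
  rw [Finset.prod_X_add_C_coeff s x (Nat.lt_succ_iff.1 (Finset.mem_range.1 hm)), eval_esymmOn,
    Polynomial.smul_eq_C_mul]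

/-- For `1 ≤ r ≤ d`, there is a polynomial with leading form `e_{n-r}^{(i)}` that vanishes on all
points for which the values `0, …, d - 1` all appear in positions other than `i`. -/
lemma exists_leadingForm_esymmOn_compl (i : Fin n) {r d : ℕ} (hr : 1 ≤ r) (hrd : r ≤ d)
    (hrn : r ≤ n) :
    ∃ f, LeadingForm f (esymmOn n {i}ᶜ (n - r)) (n - r) ∧
      ∀ x : Fin n → ℚ, (∀ l < d, ∃ p ≠ i, x p = l) → MvPolynomial.eval x f = 0 := by
  classical
  let v : Polynomial ℚ := ∏ l ∈ Finset.range d, (Polynomial.X + Polynomial.C (l : ℚ))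
  have hv : v.Monic := Polynomial.monic_prod_of_monic _ _ fun l _ => Polynomial.monic_X_add_C _
  have hvdeg : v.natDegree = d := by
    rw [Polynomial.natDegree_prod_of_monic _ _ fun l _ => Polynomial.monic_X_add_C _]
    simp only [Polynomial.natDegree_X_add_C, Finset.sum_const, Finset.card_range, smul_eq_mul,
      mul_one]
  let L : Polynomial ℚ →ₗ[ℚ] ℚ := Polynomial.lcoeff ℚ (r - 1) ∘ₗ Polynomial.modByMonicHom v
  have hL : ∀ p, L p = (p %ₘ v).coeff (r - 1) := fun p => rfl
  have hcard : ({i}ᶜ : Finset (Fin n)).card = n - 1 := by simp [Finset.card_compl]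
  have hn : n - 1 + 1 = n := by omega
  refine ⟨∑ m ∈ Finset.range n, L (Polynomial.X ^ m) • esymmOn n {i}ᶜ (n - 1 - m),
    ⟨isHomogeneous_esymmOn _ _, ?_⟩, fun x hx => ?_⟩
  · rw [← Finset.add_sum_erase (Finset.range n) _ (Finset.mem_range.2 (by omega : r - 1 < n))]
    have hsmall : ∀ m < d, L (Polynomial.X ^ m) = if m = r - 1 then 1 else 0 := by
      intro m hm
      rw [hL, (Polynomial.modByMonic_eq_self_iff hv).2, Polynomial.coeff_X_pow]
      · simp only [eq_comm]
      · rw [Polynomial.degree_X_pow, Polynomial.degree_eq_natDegree hv.ne_zero, hvdeg]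
        exact_mod_cast hm
    rw [hsmall _ (by omega), if_pos rfl, one_smul, show n - 1 - (r - 1) = n - r by omega,
      add_sub_cancel_left]
    refine Submodule.sum_mem _ fun m hm => ?_
    rw [Finset.mem_erase, Finset.mem_range] at hm
    rcases Nat.lt_or_ge m d with h | h
    · rw [hsmall m h, if_neg hm.1, zero_smul]
      exact zero_mem _
    · exact Submodule.smul_mem _ _ (degreeLT_mono (by omega)
        (IsHomogeneous.mem_degreeLT (isHomogeneous_esymmOn {i}ᶜ (n - 1 - m))))
  · have h := sum_eval_esymmOn_smul x {i}ᶜ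
    rw [hcard, hn] at h
    have hdvd : v ∣ ∏ j ∈ ({i}ᶜ : Finset (Fin n)), (Polynomial.X + Polynomial.C (x j)) := by
      have : Nonempty (Fin n) := ⟨i⟩
      choose! g hgi hgx using hx
      have hinj : Set.InjOn g (Finset.range d : Set ℕ) := by
        intro l hl m hm hlm
        rw [Finset.mem_coe, Finset.mem_range] at hl hm
        have h1 := hgx l hl
        rw [hlm, hgx m hm] at h1
        exact_mod_cast h1.symm
      have hveq : v = ∏ j ∈ (Finset.range d).image g, (Polynomial.X + Polynomial.C (x j)) := by
        rw [Finset.prod_image hinj]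
        exact Finset.prod_congr rfl fun l hl => by rw [hgx l (Finset.mem_range.1 hl)]
      rw [hveq]
      refine Finset.prod_dvd_prod_of_subset _ _ _ fun j hj => ?_
      obtain ⟨l, hl, rfl⟩ := Finset.mem_image.1 hj
      simpa using hgi l (Finset.mem_range.1 hl)
    calc MvPolynomial.eval x
          (∑ m ∈ Finset.range n, L (Polynomial.X ^ m) • esymmOn n {i}ᶜ (n - 1 - m))
        = L (∑ m ∈ Finset.range n,
            MvPolynomial.eval x (esymmOn n {i}ᶜ (n - 1 - m)) • Polynomial.X ^ m) := by
          rw [map_sum, map_sum]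
          exact Finset.sum_congr rfl fun m _ => by
            rw [L.map_smul, MvPolynomial.smul_eval, smul_eq_mul, mul_comm]
      _ = 0 := by
          rw [h, hL, (Polynomial.modByMonic_eq_zero_iff_dvd hv).2 hdvd, Polynomial.coeff_zero]

/-- Every generator of `J_n` is the leading form of a polynomial vanishing on all points
whose coordinates form an initial segment of the natural numbers. -/
lemma exists_leadingForm_Jn_generator (i : Fin n) {r d : ℕ} (hr : 1 ≤ r) (hrd : r ≤ d) :
    ∃ f e, LeadingForm f (MvPolynomial.X i ^ d * esymmOn n {i}ᶜ (n - r)) e ∧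
      ∀ w : Fin n → ℕ, (∀ p, ∀ l < w p, ∃ q, w q = l) →
        MvPolynomial.eval (fun p => (w p : ℚ)) f = 0 := by
  wlog hrn : r ≤ n generalizing r
  · have h := this (r := n) i.pos (by omega) le_rfl
    rwa [Nat.sub_self, ← Nat.sub_eq_zero_of_le (not_le.1 hrn).le] at h
  obtain ⟨f, hf, hf0⟩ := exists_leadingForm_esymmOn_compl i hr hrd hrn
  refine ⟨_, _, (leadingForm_prod_X_sub_C i (fun l => (l : ℚ)) d).mul hf, fun w hw => ?_⟩
  rw [map_mul]
  rcases Nat.lt_or_ge (w i) d with h | h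
  · refine mul_eq_zero_of_left ?_ _
    rw [map_prod]
    exact Finset.prod_eq_zero (Finset.mem_range.2 h) (by simp)
  · refine mul_eq_zero_of_right _ (hf0 _ fun l hl => ?_)
    obtain ⟨q, hq⟩ := hw i l (hl.trans_le h)
    refine ⟨q, ?_, by rw [hq]⟩
    rintro rfl
    omega

lemma sum_coverCount_le_finrank [Module.Finite ℚ (MvPolynomial (Fin n) ℚ ⧸ Jn n)] :
    ∑ m ∈ Finset.Icc 1 n, coverCount m n m ≤
      Module.finrank ℚ (MvPolynomial (Fin n) ℚ ⧸ Jn n) := by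
  classical
  let X := Σ m : Finset.Icc 1 n, {f : Fin n → Fin m // ∀ l ∈ Finset.univ, ∃ p, f p = l}
  have := Fintype.ofFinite X
  have hcard : Fintype.card X = ∑ m ∈ Finset.Icc 1 n, coverCount m n m := by
    rw [← Nat.card_eq_fintype_card, Nat.card_sigma, ← Finset.sum_coe_sort (Finset.Icc 1 n)]
    refine Finset.sum_congr rfl fun m _ => ?_
    rw [natCard_image_contains, Finset.card_univ, Fintype.card_fin]
  rw [← hcard]
  let w : X → Fin n → ℕ := fun a p => a.2.1 p
  have hle : ∀ a b : X, w a = w b → (a.1 : ℕ) ≤ b.1 := by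
    intro a b hab
    have ha := Finset.mem_Icc.1 a.1.2
    obtain ⟨p, hp⟩ := a.2.2 ⟨a.1 - 1, by omega⟩ (Finset.mem_univ _)
    have h1 : w a p = a.1 - 1 := congrArg Fin.val hp
    have h2 : w b p < b.1 := (b.2.1 p).2
    rw [← hab] at h2
    omega
  have hw : Function.Injective w := by
    intro a b hab
    have h := Subtype.ext ((hle a b hab).antisymm (hle b a hab.symm))
    obtain ⟨m, f, hf⟩ := a
    obtain ⟨m', g, hg⟩ := b
    obtain rfl : m = m' := h
    congr
    exact funext fun p => Fin.ext (congrFun hab p)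
  unfold Jn at *
  refine card_le_finrank_quotient_span (x := fun a p => (w a p : ℚ)) (fun a b hab => hw ?_) ?_
  · exact funext fun p => Nat.cast_injective (R := ℚ) (congrFun hab p)
  · rintro g ⟨i, r, d, hr, hrd, rfl⟩
    obtain ⟨f, e, hfg, hf⟩ := exists_leadingForm_Jn_generator i hr hrd
    refine ⟨f, e, hfg, fun a => hf (w a) fun p l hl => ?_⟩
    obtain ⟨q, hq⟩ := a.2.2 ⟨l, hl.trans (a.2.1 p).2⟩ (Finset.mem_univ _)
    exact ⟨q, congrArg Fin.val hq⟩

end PackedPoints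

section Ideals

variable {n : ℕ}

lemma X_pow_mul_esymmOn_mem_Jn (i : Fin n) {r d : ℕ} (hr : 1 ≤ r) (hrd : r ≤ d) :
    MvPolynomial.X i ^ d * esymmOn n {i}ᶜ (n - r) ∈ Jn n :=
  Ideal.subset_span ⟨i, r, d, hr, hrd, rfl⟩

lemma esymmOn_mem_Jnk {k j : ℕ} (h : n - k + 1 ≤ j) (hj : j ≤ n) :
    esymmOn n Finset.univ j ∈ Jnk n k :=
  Ideal.mem_sup_right (Ideal.subset_span ⟨j, h, hj, rfl⟩)

lemma Jnk_mono {k l : ℕ} (h : k ≤ l) : Jnk n k ≤ Jnk n l :=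
  sup_le_sup_left (Ideal.span_mono (by
    rintro _ ⟨j, h1, h2, rfl⟩
    exact ⟨j, by omega, h2, rfl⟩)) _

lemma Jnk_one (hn : 1 ≤ n) : Jnk n 1 = Jn n := by
  refine sup_eq_left.2 (Ideal.span_le.2 ?_)
  rintro _ ⟨j, h1, h2, rfl⟩
  obtain rfl : j = n := by omega
  have h := X_pow_mul_esymmOn_mem_Jn (⟨0, hn⟩ : Fin j) le_rfl le_rfl
  have h0 : esymmOn j {(⟨0, hn⟩ : Fin j)}ᶜ (j - 1 + 1) = 0 :=
    esymmOn_eq_zero_of_card_lt (by simp [Finset.card_compl])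
  have h2 := esymmOn_univ_succ (⟨0, hn⟩ : Fin j) (j - 1)
  rw [h0, zero_add, Nat.sub_add_cancel hn] at h2
  rw [SetLike.mem_coe, h2]
  simpa using h

lemma Ink_self_le_Jnk (hn : 1 ≤ n) : Ink n n ≤ Jnk n n := by
  refine Ideal.span_le.2 ?_
  rintro _ (⟨i, rfl⟩ | ⟨j, h1, h2, rfl⟩)
  · have h := X_pow_mul_esymmOn_mem_Jn i hn (le_refl n)
    rw [Nat.sub_self, esymmOn_zero, mul_one] at h
    exact Ideal.mem_sup_left h
  · exact esymmOn_mem_Jnk h1 h2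

lemma esymmOn_mul_mem_Jnk {k : ℕ} (hk : 1 ≤ k) (hkn : k < n) {f : MvPolynomial (Fin n) ℚ}
    (hf : f ∈ Ink n k) : esymmOn n Finset.univ (n - k) * f ∈ Jnk n k := by
  have hle : Ink n k ≤ Submodule.comap
      (LinearMap.mulLeft (MvPolynomial (Fin n) ℚ) (esymmOn n Finset.univ (n - k)))
      (Jnk n k) := by
    refine Ideal.span_le.2 ?_
    rintro _ (⟨i, rfl⟩ | ⟨j, h1, h2, rfl⟩)
    · change esymmOn n Finset.univ (n - k) * MvPolynomial.X i ^ k ∈ Jnk n k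
      have h1 := X_pow_mul_esymmOn_mem_Jn i hk le_rfl
      have h2 := X_pow_mul_esymmOn_mem_Jn i (Nat.le_add_left 1 k) le_rfl
      have h3 := esymmOn_univ_succ i (n - (k + 1))
      rw [show n - (k + 1) + 1 = n - k by omega] at h3
      refine Ideal.mem_sup_left ?_
      rw [h3]
      convert add_mem h1 h2 using 1
      ring
    · exact Ideal.mul_mem_left _ _ (esymmOn_mem_Jnk h1 h2)
  exact hle hf

lemma exists_sub_esymmOn_mul_mem_Jnk {k : ℕ} (hkn : k < n) {f : MvPolynomial (Fin n) ℚ}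
    (hf : f ∈ Jnk n (k + 1)) : ∃ g, f - esymmOn n Finset.univ (n - k) * g ∈ Jnk n k := by
  have hle : Jnk n (k + 1) ≤ Ideal.span {esymmOn n Finset.univ (n - k)} ⊔ Jnk n k := by
    refine sup_le (le_sup_left.trans le_sup_right) (Ideal.span_le.2 ?_)
    rintro _ ⟨j, h1, h2, rfl⟩
    rcases Nat.lt_or_ge (n - k) j with h | h
    · exact Ideal.mem_sup_right (esymmOn_mem_Jnk h h2)
    · obtain rfl : j = n - k := by omega
      exact Ideal.mem_sup_left (Ideal.mem_span_singleton_self _)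
  obtain ⟨_, h1, z, hz, rfl⟩ := Submodule.mem_sup.1 (hle hf)
  obtain ⟨g, rfl⟩ := Ideal.mem_span_singleton'.1 h1
  exact ⟨g, by rwa [mul_comm, add_sub_cancel_left]⟩

/-- Multiplication by `e_{n-k}` as a map `R_{n,k} → S_{n,k}`. -/
noncomputable def mulEsymm {k : ℕ} (hk : 1 ≤ k) (hkn : k < n) :
    (MvPolynomial (Fin n) ℚ ⧸ Ink n k) →ₗ[ℚ] (MvPolynomial (Fin n) ℚ ⧸ Jnk n k) :=
  (Submodule.mapQ (Ink n k) (Jnk n k)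
    (LinearMap.mulLeft (MvPolynomial (Fin n) ℚ) (esymmOn n Finset.univ (n - k)))
    fun _ hf => esymmOn_mul_mem_Jnk hk hkn hf).restrictScalars ℚ

/-- The canonical projection `S_{n,k} → S_{n,k+1}`. -/
noncomputable def projJnk (n k : ℕ) :
    (MvPolynomial (Fin n) ℚ ⧸ Jnk n k) →ₗ[ℚ] (MvPolynomial (Fin n) ℚ ⧸ Jnk n (k + 1)) :=
  (Ideal.Quotient.factorₐ ℚ (Jnk_mono (Nat.le_succ k))).toLinearMap

lemma mulEsymm_mk {k : ℕ} (hk : 1 ≤ k) (hkn : k < n) (f : MvPolynomial (Fin n) ℚ) :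
    mulEsymm hk hkn (Ideal.Quotient.mk (Ink n k) f) =
      Ideal.Quotient.mk (Jnk n k) (esymmOn n Finset.univ (n - k) * f) := rfl

lemma projJnk_mk (k : ℕ) (f : MvPolynomial (Fin n) ℚ) :
    projJnk n k (Ideal.Quotient.mk (Jnk n k) f) = Ideal.Quotient.mk (Jnk n (k + 1)) f := rfl

lemma projJnk_surjective (n k : ℕ) : Function.Surjective (projJnk n k) := fun y => by
  obtain ⟨f, rfl⟩ := Ideal.Quotient.mk_surjective y
  exact ⟨_, projJnk_mk k f⟩

lemma range_mulEsymm {k : ℕ} (hk : 1 ≤ k) (hkn : k < n) :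
    LinearMap.range (mulEsymm hk hkn) = LinearMap.ker (projJnk n k) := by
  ext y
  rw [LinearMap.mem_range, LinearMap.mem_ker]
  constructor
  · rintro ⟨x, rfl⟩
    obtain ⟨f, rfl⟩ := Ideal.Quotient.mk_surjective x
    rw [mulEsymm_mk, projJnk_mk, Ideal.Quotient.eq_zero_iff_mem]
    exact Ideal.mul_mem_right _ _ (esymmOn_mem_Jnk (by omega) (by omega))
  · intro hy
    obtain ⟨f, rfl⟩ := Ideal.Quotient.mk_surjective y
    rw [projJnk_mk, Ideal.Quotient.eq_zero_iff_mem] at hy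
    obtain ⟨g, hg⟩ := exists_sub_esymmOn_mul_mem_Jnk hkn hy
    exact ⟨Ideal.Quotient.mk _ g, by rw [mulEsymm_mk]; exact (Ideal.Quotient.eq.2 hg).symm⟩

lemma finite_quotient_Jnk {k : ℕ} (hk : 1 ≤ k) (hkn : k ≤ n) :
    Module.Finite ℚ (MvPolynomial (Fin n) ℚ ⧸ Jnk n k) := by
  induction hkn using Nat.decreasingInduction with
  | self =>
    have := (finite_and_finrank_quotient_Ink_le (le_refl n)).1
    exact Module.Finite.of_surjective
      (Ideal.Quotient.factorₐ ℚ (Ink_self_le_Jnk hk)).toLinearMap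
      (Ideal.Quotient.factor_surjective (Ink_self_le_Jnk hk))
  | of_succ k hkn ih =>
    have h1 := ih (by omega)
    have h2 := (finite_and_finrank_quotient_Ink_le hkn.le).1
    have hker : (LinearMap.ker (projJnk n k)).FG := by
      rw [← range_mulEsymm hk hkn, ← Module.Finite.iff_fg]
      infer_instance
    have hrange : (Submodule.map (projJnk n k) ⊤).FG := by
      rw [Submodule.map_top, LinearMap.range_eq_top.2 (projJnk_surjective n k)]
      exact h1.fg_top
    exact ⟨Submodule.fg_of_fg_map_of_fg_inf_ker (projJnk n k) hrange (by simpa using hker)⟩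

lemma finrank_quotient_Jnk_eq {k : ℕ} (hk : 1 ≤ k) (hkn : k < n) :
    Module.finrank ℚ (MvPolynomial (Fin n) ℚ ⧸ Jnk n k) =
      Module.finrank ℚ (MvPolynomial (Fin n) ℚ ⧸ Jnk n (k + 1)) +
        Module.finrank ℚ (LinearMap.range (mulEsymm hk hkn)) := by
  have := finite_quotient_Jnk hk hkn.le
  rw [range_mulEsymm, ← LinearMap.finrank_range_add_finrank_ker (projJnk n k),
    LinearMap.range_eq_top.2 (projJnk_surjective n k), finrank_top]

lemma finrank_quotient_Jnk_le_add {k : ℕ} (hk : 1 ≤ k) (hkn : k < n) :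
    Module.finrank ℚ (MvPolynomial (Fin n) ℚ ⧸ Jnk n k) ≤
      Module.finrank ℚ (MvPolynomial (Fin n) ℚ ⧸ Jnk n (k + 1)) + coverCount k n k := by
  obtain ⟨h1, h2⟩ := finite_and_finrank_quotient_Ink_le (n := n) hkn.le
  rw [finrank_quotient_Jnk_eq hk hkn]
  exact Nat.add_le_add_left ((LinearMap.finrank_range_le _).trans h2) _

lemma finrank_quotient_Jnk_le {k : ℕ} (hk : 1 ≤ k) (hkn : k ≤ n) :
    Module.finrank ℚ (MvPolynomial (Fin n) ℚ ⧸ Jnk n k) ≤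
      ∑ m ∈ Finset.Ico k (n + 1), coverCount m n m := by
  induction hkn using Nat.decreasingInduction with
  | self =>
    obtain ⟨h1, h2⟩ := finite_and_finrank_quotient_Ink_le (le_refl n)
    have h3 := LinearMap.finrank_le_finrank_of_surjective
      (f := (Ideal.Quotient.factorₐ ℚ (Ink_self_le_Jnk hk)).toLinearMap)
      (Ideal.Quotient.factor_surjective (Ink_self_le_Jnk hk))
    simpa using h3.trans h2
  | of_succ k hkn ih =>
    have h1 := ih (by omega)
    have h2 := finrank_quotient_Jnk_le_add hk hkn
    rw [Finset.sum_eq_sum_Ico_succ_bot (by omega : k < n + 1)]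
    omega

lemma sum_coverCount_le_finrank_quotient_Jnk {k : ℕ} (hk : 1 ≤ k) (hkn : k ≤ n) :
    ∑ m ∈ Finset.Ico k (n + 1), coverCount m n m ≤
      Module.finrank ℚ (MvPolynomial (Fin n) ℚ ⧸ Jnk n k) := by
  induction k, hk using Nat.le_induction with
  | base =>
    have h := finite_quotient_Jnk le_rfl hkn
    rw [Jnk_one hkn] at h ⊢
    exact sum_coverCount_le_finrank
  | succ k hk ih =>
    have h1 := ih (by omega)
    have h2 := finrank_quotient_Jnk_le_add hk hkn
    rw [Finset.sum_eq_sum_Ico_succ_bot (by omega : k < n + 1)] at h1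
    omega

lemma mulEsymm_injective {k : ℕ} (hk : 1 ≤ k) (hkn : k < n) :
    Function.Injective (mulEsymm hk hkn) := by
  obtain ⟨hfin, hle⟩ := finite_and_finrank_quotient_Ink_le (n := n) hkn.le
  have h1 := sum_coverCount_le_finrank_quotient_Jnk hk hkn.le
  have h2 := finrank_quotient_Jnk_le (Nat.le_add_left 1 k) hkn
  rw [Finset.sum_eq_sum_Ico_succ_bot (by omega : k < n + 1), finrank_quotient_Jnk_eq hk hkn] at h1
  have h3 := LinearMap.finrank_range_add_finrank_ker (mulEsymm hk hkn)
  rw [← LinearMap.ker_eq_bot, ← Submodule.finrank_eq_zero]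
  omega

end Ideals

/-- for `1 ≤ k ≤ n - 1`, the sequence
`0 → R_{n,k} →^φ S_{n,k} →^π S_{n,k+1} → 0` is exact, where `π` is the canonical
projection and `φ` is induced by multiplication by `e_{n-k}`: `φ` is injective, `π` is
surjective, and the image of `φ` equals the kernel of `π`. -/
theorem exact_sequence (n k : ℕ) (hk : 1 ≤ k) (hkn : k ≤ n - 1) :
    ∃ (φ : (MvPolynomial (Fin n) ℚ ⧸ Ink n k) →ₗ[ℚ] (MvPolynomial (Fin n) ℚ ⧸ Jnk n k))
      (π : (MvPolynomial (Fin n) ℚ ⧸ Jnk n k) →ₗ[ℚ]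
        (MvPolynomial (Fin n) ℚ ⧸ Jnk n (k + 1))),
      (∀ f : MvPolynomial (Fin n) ℚ,
        φ (Ideal.Quotient.mk (Ink n k) f) =
          Ideal.Quotient.mk (Jnk n k)
            (esymmOn n (Finset.univ : Finset (Fin n)) (n - k) * f)) ∧
      (∀ f : MvPolynomial (Fin n) ℚ,
        π (Ideal.Quotient.mk (Jnk n k) f) = Ideal.Quotient.mk (Jnk n (k + 1)) f) ∧
      Function.Injective φ ∧ Function.Surjective π ∧
      LinearMap.range φ = LinearMap.ker π := by
  have hkn' : k < n := by omega
  exact ⟨mulEsymm hk hkn', projJnk n k, mulEsymm_mk hk hkn', projJnk_mk k,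
    mulEsymm_injective hk hkn', projJnk_surjective n k, range_mulEsymm hk hkn'⟩

end PackedWords
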